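/- A finite Coxeter group W is irreducible if and only if W contains a reflection whose support (the set of simple reflections appearing in any reduced expression of it) equals the full set S of simple reflections. -/

import Mathlib

open CoxeterSystem

variable {B W : Type*} [Group W] {M : CoxeterMatrix B}

/-- The support of `w`: the set of indices of simple reflections appearing in some reduced
expression of `w`. -/
def CoxeterSystem.support (cs : CoxeterSystem M W) (w : W) : Set B :=
  {i | ∃ ω : List B, cs.IsReduced ω ∧ cs.wordProd ω = w ∧ i ∈ ω}

/-- Irreducibility of a Coxeter system, expressed via its Coxeter matrix: the Coxeter graph is
connected, i.e. the vertex set is nonempty and cannot be partitioned into two nonempty parts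
such that all generators of one part commute with all generators of the other
(equivalently, `W` is not the direct product of two proper standard parabolic subgroups). -/
def CoxeterMatrix.IsIrreducible (M : CoxeterMatrix B) : Prop :=
  Nonempty B ∧ ¬ ∃ S₁ S₂ : Set B, S₁.Nonempty ∧ S₂.Nonempty ∧ Disjoint S₁ S₂ ∧
    S₁ ∪ S₂ = Set.univ ∧ ∀ i ∈ S₁, ∀ j ∈ S₂, M i j = 2

section DihedralRelation

open Module Polynomial.Chebyshev

/-- If `f y * g x = 4 cos² (π / m)`, then the product of the reflections defined by `(x, f)` and
`(y, g)` has order dividing `m`. -/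
theorem Module.reflection_mul_reflection_pow_eq_one {V : Type*} [AddCommGroup V] [Module ℝ V]
    {x y : V} {f g : Dual ℝ V} (hf : f x = 2) (hg : g y = 2) {m : ℕ} (hm : 3 ≤ m)
    (h : f y * g x = 4 * Real.cos (Real.pi / m) ^ 2) :
    (reflection hf * reflection hg) ^ m = 1 := by
  have hm' : (3 : ℝ) ≤ m := by exact_mod_cast hm
  have hm0 : (m : ℝ) ≠ 0 := by positivity
  set θ : ℝ := 2 * (Real.pi / m) with hθ
  have ht : 2 * Real.cos θ = f y * g x - 2 := by rw [h, hθ, Real.cos_two_mul]; ring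
  have hmθ : m * θ = 2 * Real.pi := by rw [hθ]; field_simp
  have hsin : Real.sin θ ≠ 0 := by
    refine (Real.sin_pos_of_pos_of_lt_pi (by positivity) ?_).ne'
    nlinarith [Real.pi_pos]
  have hS (k : ℤ) := S_two_mul_real_cos θ k
  ext z
  rw [reflection_mul_reflection_pow_apply hf hg m z _ ht]
  obtain ⟨k, rfl | rfl⟩ := m.even_or_odd'
  · have hk : (S ℝ ((k : ℤ) - 1)).eval (2 * Real.cos θ) = 0 := by
      refine (mul_eq_zero_iff_right hsin).mp ?_
      rw [hS, show (((k : ℤ) - 1 : ℤ) + 1 : ℝ) * θ = Real.pi by push_cast at hmθ ⊢; linarith,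
        Real.sin_pi]
    rw [show (((2 * k : ℕ) : ℤ) - 2) / 2 = k - 1 by lia,
      show (((2 * k : ℕ) : ℤ) - 1) / 2 = k - 1 by lia, hk]
    simp
  · have hk : (S ℝ (k : ℤ)).eval (2 * Real.cos θ) +
        (S ℝ ((k : ℤ) - 1)).eval (2 * Real.cos θ) = 0 := by
      refine (mul_eq_zero_iff_right hsin).mp ?_
      rw [add_mul, hS, hS, show (((k : ℤ) - 1 : ℤ) + 1 : ℝ) * θ =
        2 * Real.pi - ((k : ℤ) + 1 : ℝ) * θ by push_cast at hmθ ⊢; linarith, Real.sin_two_pi_sub]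
      ring
    rw [show (((2 * k + 1 : ℕ) : ℤ) - 2) / 2 = k - 1 by lia,
      show (((2 * k + 1 : ℕ) : ℤ) - 1) / 2 = k by lia,
      show (((2 * k + 1 : ℕ) : ℤ) - 3) / 2 = k - 1 by lia,
      show (((2 * k + 1 : ℕ) : ℤ)) / 2 = k by lia, hk]
    simp

end DihedralRelation

namespace CoxeterMatrix

open Module

variable (M)

/-- The simple coroot `2⟨αᵢ, ·⟩`, where `⟨αᵢ, αⱼ⟩ = - cos (π / M i j)`. -/
noncomputable def simpleCoroot (i : B) : Dual ℝ (B →₀ ℝ) :=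
  Finsupp.linearCombination ℝ fun j ↦ -2 * Real.cos (Real.pi / M i j)

theorem simpleCoroot_single (i j : B) :
    M.simpleCoroot i (Finsupp.single j 1) = -2 * Real.cos (Real.pi / M i j) := by
  simp [simpleCoroot]

theorem simpleCoroot_single_self (i : B) : M.simpleCoroot i (Finsupp.single i 1) = 2 := by
  simp [simpleCoroot_single]

/-- The reflection in the simple root `αᵢ`. -/
noncomputable def simpleReflection (i : B) : (B →₀ ℝ) ≃ₗ[ℝ] (B →₀ ℝ) :=
  reflection (M.simpleCoroot_single_self i)

theorem simpleReflection_apply (i : B) (v : B →₀ ℝ) :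
    M.simpleReflection i v = v - M.simpleCoroot i v • Finsupp.single i 1 :=
  reflection_apply _ _

theorem isLiftable_simpleReflection : M.IsLiftable M.simpleReflection := by
  intro i j
  have hM : M i j = 0 ∨ M i j = 1 ∨ M i j = 2 ∨ 3 ≤ M i j := by lia
  rcases hM with h | h | h | h
  · rw [h, pow_zero]
  · obtain rfl : i = j := by
      by_contra hij
      exact M.off_diagonal i j hij h
    rw [h, pow_one]
    ext1 v
    exact involutive_reflection (M.simpleCoroot_single_self i) v
  · have hij : M.simpleCoroot i (Finsupp.single j 1) = 0 := by simp [simpleCoroot_single, h]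
    have hji : M.simpleCoroot j (Finsupp.single i 1) = 0 := by
      simp [simpleCoroot_single, M.symmetric j i, h]
    rw [h]
    ext1 v
    simp only [pow_two, LinearEquiv.mul_apply, simpleReflection_apply, map_sub, map_smul, hij, hji,
      simpleCoroot_single_self, LinearEquiv.coe_one, id_eq]
    module
  · refine reflection_mul_reflection_pow_eq_one _ _ h ?_
    rw [simpleCoroot_single, simpleCoroot_single, M.symmetric j i]
    ring

variable {M}

theorem cos_pi_div_nonneg {i j : B} (hij : i ≠ j) : 0 ≤ Real.cos (Real.pi / M i j) := by
  have h1 := M.off_diagonal i j hij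
  obtain h | h : M i j = 0 ∨ 2 ≤ M i j := by lia
  · simp [h]
  · have h' : (2 : ℝ) ≤ M i j := by exact_mod_cast h
    refine Real.cos_nonneg_of_neg_pi_div_two_le_of_le ?_ (by gcongr)
    have : 0 ≤ Real.pi / M i j := by positivity
    linarith [Real.pi_pos]

theorem cos_pi_div_pos {i j : B} (hij : i ≠ j) (h2 : M i j ≠ 2) :
    0 < Real.cos (Real.pi / M i j) := by
  have h1 := M.off_diagonal i j hij
  obtain h | h : M i j = 0 ∨ 3 ≤ M i j := by lia
  · simp [h]
  · have h' : (2 : ℝ) < M i j := by exact_mod_cast h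
    refine Real.cos_pos_of_mem_Ioo ⟨?_, by gcongr⟩
    have : 0 ≤ Real.pi / M i j := by positivity
    linarith [Real.pi_pos]

theorem simpleCoroot_neg {v : B →₀ ℝ} (hv : 0 ≤ v) {i j : B} (hi : i ∈ v.support)
    (hj : j ∉ v.support) (h2 : M j i ≠ 2) : M.simpleCoroot j v < 0 := by
  have hne {k : B} (hk : k ∈ v.support) : j ≠ k := fun h ↦ hj (h ▸ hk)
  rw [simpleCoroot, Finsupp.linearCombination_apply, Finsupp.sum]
  refine Finset.sum_neg' (fun k hk ↦ ?_) ⟨i, hi, ?_⟩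
  · have := mul_nonneg (hv k) (cos_pi_div_nonneg (M := M) (hne hk))
    simp only [smul_eq_mul]
    linarith
  · have hpos : 0 < v i := lt_of_le_of_ne (hv i) (Finsupp.mem_support_iff.mp hi).symm
    have := mul_pos hpos (cos_pi_div_pos (hne hi) h2)
    simp only [smul_eq_mul]
    linarith

end CoxeterMatrix

namespace CoxeterSystem

variable (cs : CoxeterSystem M W)

/-- The geometric representation of a Coxeter group. -/
noncomputable def geometricRep : W →* ((B →₀ ℝ) ≃ₗ[ℝ] (B →₀ ℝ)) :=
  cs.lift ⟨M.simpleReflection, M.isLiftable_simpleReflection⟩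

theorem geometricRep_simple (i : B) : cs.geometricRep (cs.simple i) = M.simpleReflection i :=
  cs.lift_apply_simple M.isLiftable_simpleReflection i

theorem simple_injective : Function.Injective cs.simple := by
  intro i j hij
  by_contra hne
  have h := DFunLike.congr_fun (congrArg cs.geometricRep hij) (Finsupp.single i 1)
  rw [geometricRep_simple, geometricRep_simple, M.simpleReflection_apply, M.simpleReflection_apply,
    M.simpleCoroot_single_self] at h
  have h' := DFunLike.congr_fun h i
  simp [Finsupp.single_eq_of_ne hne] at h'

theorem geometricRep_wordProd_sub_mem (ω : List B) (v : B →₀ ℝ) :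
    cs.geometricRep (cs.wordProd ω) v - v ∈ Finsupp.supported ℝ ℝ {i | i ∈ ω} := by
  induction ω with
  | nil => simp
  | cons i ω ih =>
    rw [wordProd_cons, map_mul, LinearEquiv.mul_apply, geometricRep_simple,
      M.simpleReflection_apply, sub_right_comm]
    refine Submodule.sub_mem _ (Finsupp.supported_mono (fun j hj ↦ List.mem_cons_of_mem i hj) ih)
      (Submodule.smul_mem _ _ (Finsupp.single_mem_supported ℝ _ (by simp)))

/-- Every word for a reflection contains all letters in the support of the corresponding root. -/
theorem mem_of_wordProd_eq_conj {ω : List B} {w : W} {i : B}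
    (h : cs.wordProd ω = w * cs.simple i * w⁻¹) {j : B}
    (hj : j ∈ (cs.geometricRep w (Finsupp.single i 1)).support) : j ∈ ω := by
  have hmem := cs.geometricRep_wordProd_sub_mem ω (cs.geometricRep w (Finsupp.single i 1))
  have hinv : cs.geometricRep w⁻¹ (cs.geometricRep w (Finsupp.single i 1)) =
      Finsupp.single i 1 := by
    rw [← LinearEquiv.mul_apply, ← map_mul]; simp
  rw [h, map_mul, map_mul, LinearEquiv.mul_apply, LinearEquiv.mul_apply, hinv, geometricRep_simple,
    M.simpleReflection_apply, M.simpleCoroot_single_self, Finsupp.mem_supported] at hmem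
  refine hmem (Finsupp.mem_support_iff.mpr ?_)
  have hj' := Finsupp.mem_support_iff.mp hj
  intro h0
  simp only [map_sub, map_smul, Finsupp.sub_apply, Finsupp.smul_apply, smul_eq_mul] at h0
  exact hj' (by linarith)

/-- The positive root of full support of an irreducible Coxeter system of finite rank. -/
theorem exists_root_support_eq_univ [Finite B] (hM : M.IsIrreducible) :
    ∃ w i, ∀ j, j ∈ (cs.geometricRep w (Finsupp.single i 1)).support := by
  classical
  let P : Set (Finset B) := {s | ∃ w i, 0 ≤ cs.geometricRep w (Finsupp.single i 1) ∧
    (cs.geometricRep w (Finsupp.single i 1)).support = s}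
  obtain ⟨⟨i₀⟩, hM⟩ := hM
  have hP : P.Nonempty := ⟨_, 1, i₀, by simp [Finsupp.single_nonneg], rfl⟩
  obtain ⟨s, ⟨w, i, hpos, rfl⟩, hmax⟩ := P.toFinite.exists_maximal hP
  refine ⟨w, i, ?_⟩
  set β := cs.geometricRep w (Finsupp.single i 1) with hβ
  by_contra! ⟨j₀, hj₀⟩
  have hβ0 : β ≠ 0 := by simp [hβ]
  refine hM ⟨{k | k ∉ β.support}, β.support, ⟨j₀, hj₀⟩, Finsupp.support_nonempty_iff.mpr hβ0,
    disjoint_compl_left, Set.compl_union_self _, fun j hj k hk ↦ ?_⟩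
  by_contra h2
  have hneg := CoxeterMatrix.simpleCoroot_neg hpos hk hj h2
  have heq : cs.geometricRep (cs.simple j * w) (Finsupp.single i 1) =
      β + Finsupp.single j (-M.simpleCoroot j β) := by
    rw [map_mul, LinearEquiv.mul_apply, geometricRep_simple, M.simpleReflection_apply, ← hβ]
    simp [sub_eq_add_neg]
  have hnn : 0 ≤ Finsupp.single j (-M.simpleCoroot j β) :=
    Finsupp.single_nonneg.mpr (by linarith)
  have hle : β ≤ β + Finsupp.single j (-M.simpleCoroot j β) := le_add_of_nonneg_right hnn
  have hsub : β.support ≤ (β + Finsupp.single j (-M.simpleCoroot j β)).support := by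
    intro l hl
    rw [Finsupp.mem_support_iff] at hl ⊢
    have h1 : 0 < β l := lt_of_le_of_ne (hpos l) hl.symm
    exact (h1.trans_le (hle l)).ne'
  have hmem := hmax ⟨cs.simple j * w, i, by rw [heq]; exact add_nonneg hpos hnn, by rw [heq]⟩ hsub
  refine hj (hmem (Finsupp.mem_support_iff.mpr ?_))
  rw [Finsupp.add_apply, Finsupp.single_eq_same, Finsupp.notMem_support_iff.mp hj]
  linarith

section Retraction

open Classical in
/-- If `S` and its complement commute, the retraction onto the parabolic subgroup generated by `S`
killing all other simple reflections is well defined. -/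
theorem isLiftable_ite_mem {S : Set B} (h : ∀ i ∈ S, ∀ j ∉ S, M i j = 2) :
    M.IsLiftable fun i ↦ if i ∈ S then cs.simple i else 1 := by
  intro i j
  by_cases hi : i ∈ S <;> by_cases hj : j ∈ S
  · simp [hi, hj]
  · simp [hi, hj, h i hi j hj]
  · simp [hi, hj, M.symmetric i j, h j hj i hi]
  · simp [hi, hj]

/-- The retraction onto the parabolic subgroup generated by `S`, killing all simple reflections
outside `S`. -/
noncomputable def retraction {S : Set B} (h : ∀ i ∈ S, ∀ j ∉ S, M i j = 2) : W →* W :=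
  cs.lift ⟨_, cs.isLiftable_ite_mem h⟩

variable {S : Set B} (h : ∀ i ∈ S, ∀ j ∉ S, M i j = 2)

open Classical in
theorem retraction_simple (i : B) :
    cs.retraction h (cs.simple i) = if i ∈ S then cs.simple i else 1 :=
  cs.lift_apply_simple (cs.isLiftable_ite_mem h) i

open Classical in
theorem retraction_wordProd (ω : List B) :
    cs.retraction h (cs.wordProd ω) = cs.wordProd (ω.filter (· ∈ S)) := by
  induction ω with
  | nil => simp
  | cons i ω ih =>
    by_cases hi : i ∈ S <;> simp [wordProd_cons, retraction_simple, hi, ih]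

theorem commute_simple {i j : B} (hij : M i j = 2) : Commute (cs.simple i) (cs.simple j) := by
  have h := cs.simple_mul_simple_pow i j
  rw [hij, pow_two, mul_eq_one_iff_eq_inv] at h
  simpa [Commute, SemiconjBy] using h

theorem retraction_mul_retraction_compl (h' : ∀ i ∈ Sᶜ, ∀ j ∉ Sᶜ, M i j = 2) (w : W) :
    cs.retraction h w * cs.retraction h' w = w := by
  have hcomm (i : B) (hi : i ∉ S) (w : W) : Commute (cs.retraction h w) (cs.simple i) := by
    induction w using cs.simple_induction with
    | simple j =>
      rw [retraction_simple]
      split_ifs with hj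
      · exact cs.commute_simple (h j hj i hi)
      · exact Commute.one_left _
    | one => rw [map_one]; exact Commute.one_left _
    | mul w w' hw hw' => rw [map_mul]; exact hw.mul_left hw'
  induction w using cs.simple_induction_left with
  | one => simp
  | mul_simple_left w i ih =>
    rw [map_mul, map_mul, retraction_simple, retraction_simple]
    by_cases hi : i ∈ S
    · simp [hi, mul_assoc, ih]
    · simp only [hi, Set.mem_compl_iff, not_false_eq_true, if_true, if_false, one_mul]
      rw [← mul_assoc, (hcomm i hi w).eq, mul_assoc, ih]

/-- An element killed by the retraction onto the parabolic subgroup generated by `S` has support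
disjoint from `S`. -/
theorem disjoint_support_of_retraction_eq_one {w : W} (hw : cs.retraction h w = 1) :
    Disjoint (cs.support w) S := by
  rw [Set.disjoint_left]
  rintro i ⟨ω, hω, rfl, hi⟩ hiS
  have h' : ∀ i ∈ Sᶜ, ∀ j ∉ Sᶜ, M i j = 2 := fun i hi j hj ↦ by
    rw [M.symmetric]; exact h j (not_not.mp hj) i hi
  have heq := cs.retraction_mul_retraction_compl h h' (cs.wordProd ω)
  rw [hw, one_mul, retraction_wordProd] at heq
  have hlen := (hω.eq.symm.trans (congrArg cs.length heq.symm)).le.trans (cs.length_wordProd_le _)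
  have hfil := List.filter_eq_self.mp
    (List.filter_sublist.eq_of_length (le_antisymm (List.length_filter_le _ _) hlen)) i hi
  simp [hiS] at hfil

end Retraction

theorem IsReflection.isIrreducible {cs : CoxeterSystem M W} {t : W} (ht : cs.IsReflection t)
    (hsupp : cs.support t = Set.univ) : M.IsIrreducible := by
  obtain ⟨w, i, rfl⟩ := ht
  refine ⟨⟨i⟩, ?_⟩
  have key (S : Set B) (hS : S.Nonempty) (hi : i ∉ S) (h : ∀ i ∈ S, ∀ j ∉ S, M i j = 2) :
      False := by
    have hdisj := cs.disjoint_support_of_retraction_eq_one h (w := w * cs.simple i * w⁻¹)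
      (by simp [retraction_simple, hi])
    rw [hsupp, Set.univ_disjoint] at hdisj
    exact hS.ne_empty hdisj
  rintro ⟨S₁, S₂, h₁, h₂, hd, hu, h⟩
  obtain rfl : S₂ = S₁ᶜ := (IsCompl.of_eq hd.inter_eq hu).compl_eq.symm
  by_cases hi : i ∈ S₁
  · exact key S₁ᶜ h₂ (not_not.mpr hi) fun j hj k hk ↦ by
      rw [M.symmetric]; exact h k (not_not.mp hk) j hj
  · exact key S₁ h₁ hi h

end CoxeterSystem

/-- A finite Coxeter group is irreducible if and only if it has a reflection of full support. -/
theorem statement0 (cs : CoxeterSystem M W) [Finite W] :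
    M.IsIrreducible ↔ ∃ t : W, cs.IsReflection t ∧ cs.support t = Set.univ := by
  refine ⟨fun hM ↦ ?_, fun ⟨t, ht, hsupp⟩ ↦ ht.isIrreducible hsupp⟩
  have : Finite B := Finite.of_injective _ cs.simple_injective
  obtain ⟨w, i, hfull⟩ := cs.exists_root_support_eq_univ hM
  obtain ⟨ω, hω, heq⟩ := cs.exists_isReduced (w * cs.simple i * w⁻¹)
  exact ⟨_, ⟨w, i, rfl⟩, Set.eq_univ_of_forall fun j ↦
    ⟨ω, hω, heq.symm, cs.mem_of_wordProd_eq_conj heq.symm (hfull j)⟩⟩
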